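/- (Average version of Harman's asymptotic sieve.) Let x ≥ 2, let P be a finite index set, and for each p ∈ P let A_p and B_p be finite sets of positive integers. Let λ > 0, 0 < α < 1, 0 < β ≤ 1/2, M > x^α and Y ≥ 1 be fixed. Suppose that for all sequences (a_m)_{m∈ℕ} and (b_n)_{n∈ℕ} of complex numbers with |a_m| ≤ τ(m) and |b_n| ≤ τ(n) one has Σ_{p∈P} |Σ_{mn∈A_p, m≤M} a_m − λ·Σ_{mn∈B_p, m≤M} a_m|² ≤ Y and Σ_{p∈P} |Σ_{mn∈A_p, x^α < m ≤ x^{α+β}} a_m b_n − λ·Σ_{mn∈B_p, x^α < m ≤ x^{α+β}} a_m b_n|² ≤ Y. Then Σ_{p∈P} |S(A_p, x^β) − λ·S(B_p, x^β)|² = O(Y·(log x)^6), with an absolute implied constant. -/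

import Mathlib

open scoped Classical
open Finset

/-- `S(M, z)`: number of elements of `M` all of whose prime divisors are `≥ z`. -/
noncomputable def sieveCount (M : Finset ℕ) (z : ℝ) : ℕ :=
  (M.filter (fun n => ∀ p : ℕ, p.Prime → p ∣ n → z ≤ (p : ℝ))).card

/-- Sum of `a m` over pairs `(m, n)` of positive integers with `m * n ∈ A` and
`m` satisfying the predicate `P` (expressed via divisors). -/
noncomputable def typeISum (A : Finset ℕ) (P : ℕ → Prop) (a : ℕ → ℂ) : ℂ :=
  ∑ k ∈ A, ∑ m ∈ k.divisors.filter P, a m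

/-- Sum of `a m * b n` over pairs `(m, n)` of positive integers with `m * n ∈ A`
and `m` satisfying the predicate `P`. -/
noncomputable def typeIISum (A : Finset ℕ) (P : ℕ → Prop) (a b : ℕ → ℂ) : ℂ :=
  ∑ k ∈ A, ∑ m ∈ k.divisors.filter P, a m * b (k / m)

section Separation

variable {E : Type*} [NormedAddCommGroup E] [NormedSpace ℂ E]

/-- Orthogonality of additive characters separates the condition `u m = v n` at no cost. -/
lemma norm_map_mul_indicator_eq_le (T : (ℕ → ℕ → ℂ) →ₗ[ℂ] E) {f g : ℕ → ℝ} {C : ℝ}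
    (hT : ∀ a b : ℕ → ℂ, (∀ m, ‖a m‖ ≤ f m) → (∀ n, ‖b n‖ ≤ g n) →
      ‖T (fun m n => a m * b n)‖ ≤ C)
    {a b : ℕ → ℂ} (ha : ∀ m, ‖a m‖ ≤ f m) (hb : ∀ n, ‖b n‖ ≤ g n)
    {H : ℕ} {u v : ℕ → ℕ} (hu : ∀ m, u m < H) (hv : ∀ n, v n < H) :
    ‖T (fun m n => a m * b n * if u m = v n then 1 else 0)‖ ≤ C := by
  have : NeZero H := ⟨(Nat.zero_lt_of_lt (hu 0)).ne'⟩
  have hH : (H : ℂ) ≠ 0 := NeZero.ne _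
  have key : (fun m n => a m * b n * if u m = v n then (1 : ℂ) else 0) =
      (H : ℂ)⁻¹ • ∑ ψ : AddChar (ZMod H) ℂ,
        fun m n => (a m * ψ (u m : ZMod H)) * (b n * ψ (-(v n : ZMod H))) := by
    funext m n
    have h := AddChar.sum_apply_eq_ite (α := ZMod H) ((u m : ZMod H) + -(v n : ZMod H))
    have h2 : ((u m : ZMod H) + -(v n : ZMod H) = 0) ↔ u m = v n := by
      rw [← sub_eq_add_neg, sub_eq_zero, ZMod.natCast_eq_natCast_iff]
      refine ⟨fun h => ?_, fun h => by rw [h]⟩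
      exact Nat.ModEq.eq_of_lt_of_lt h (hu m) (hv n)
    simp only [h2, ZMod.card, AddChar.map_add_eq_mul] at h
    have h3 : ∑ ψ : AddChar (ZMod H) ℂ,
        (a m * ψ (u m : ZMod H)) * (b n * ψ (-(v n : ZMod H))) =
        a m * b n * if u m = v n then (H : ℂ) else 0 := by
      rw [← h, Finset.mul_sum]
      exact Finset.sum_congr rfl fun ψ _ => by ring
    simp only [Pi.smul_apply, Finset.sum_apply, h3, smul_eq_mul]
    split_ifs
    · field_simp
    · simp
  rw [key, map_smul, map_sum, norm_smul, norm_inv, Complex.norm_natCast]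
  have hle : ‖∑ ψ : AddChar (ZMod H) ℂ,
      T (fun m n => (a m * ψ (u m : ZMod H)) * (b n * ψ (-(v n : ZMod H))))‖ ≤ H * C := by
    refine (norm_sum_le_of_le _ fun ψ _ => hT _ _ (fun m => ?_) fun n => ?_).trans_eq
      (b := ∑ _ψ : AddChar (ZMod H) ℂ, C) ?_
    · simpa [AddChar.norm_apply] using ha m
    · simpa only [norm_mul, AddChar.norm_apply, mul_one] using hb n
    · rw [Finset.sum_const, Finset.card_univ, nsmul_eq_mul, AddChar.card_eq, ZMod.card]
  have hHpos : (0 : ℝ) < H := by exact_mod_cast Nat.zero_lt_of_lt (hu 0)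
  calc (H : ℝ)⁻¹ * _ ≤ (H : ℝ)⁻¹ * (H * C) := by gcongr
    _ = C := by field_simp

/-- Comparison of binary expansions: `u < v` is decided at the highest differing digit. -/
lemma indicator_lt_eq_sum_binary (L : ℕ) (u v : ℕ) :
    (if u < v then (1 : ℂ) else 0) =
      (∑ i ∈ Finset.range L, (if u / 2 ^ i % 2 = 0 then 1 else 0) *
        (if v / 2 ^ i % 2 = 1 then 1 else 0) *
        (if u / 2 ^ (i + 1) = v / 2 ^ (i + 1) then 1 else 0)) +
      if u / 2 ^ L < v / 2 ^ L then 1 else 0 := by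
  induction L with
  | zero => simp
  | succ L ih =>
    rw [ih, Finset.sum_range_succ, add_assoc]
    congr 1
    simp only [pow_succ, ← Nat.div_div_eq_div_mul]
    generalize u / 2 ^ L = s
    generalize v / 2 ^ L = t
    split_ifs <;> first | omega | simp

/-- The condition `u m < v n` for `u, v < 2 ^ L` is separated at the cost of a factor `L`. -/
lemma norm_map_mul_indicator_lt_le (T : (ℕ → ℕ → ℂ) →ₗ[ℂ] E) {f g : ℕ → ℝ} {C : ℝ}
    (hT : ∀ a b : ℕ → ℂ, (∀ m, ‖a m‖ ≤ f m) → (∀ n, ‖b n‖ ≤ g n) →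
      ‖T (fun m n => a m * b n)‖ ≤ C)
    {a b : ℕ → ℂ} (ha : ∀ m, ‖a m‖ ≤ f m) (hb : ∀ n, ‖b n‖ ≤ g n)
    {L : ℕ} {u v : ℕ → ℕ} (hu : ∀ m, u m < 2 ^ L) (hv : ∀ n, v n < 2 ^ L) :
    ‖T (fun m n => a m * b n * if u m < v n then 1 else 0)‖ ≤ L * C := by
  have key : (fun m n => a m * b n * if u m < v n then (1 : ℂ) else 0) =
      ∑ i ∈ Finset.range L, fun m n =>
        (a m * if u m / 2 ^ i % 2 = 0 then 1 else 0) *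
        (b n * if v n / 2 ^ i % 2 = 1 then 1 else 0) *
        if u m / 2 ^ (i + 1) = v n / 2 ^ (i + 1) then 1 else 0 := by
    funext m n
    rw [indicator_lt_eq_sum_binary L, Nat.div_eq_of_lt (hu m), Nat.div_eq_of_lt (hv n)]
    simp only [lt_irrefl, if_false, add_zero, Finset.sum_apply, Finset.mul_sum]
    exact Finset.sum_congr rfl fun i _ => by ring
  rw [key, map_sum]
  refine (norm_sum_le_of_le _ fun i _ => norm_map_mul_indicator_eq_le T hT (H := 2 ^ L)
    (fun m => ?_) (fun n => ?_) (fun m => ?_) fun n => ?_).trans_eq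
      (b := ∑ _i ∈ Finset.range L, C) (by simp)
  · split_ifs
    · simpa using ha m
    · simpa using (norm_nonneg _).trans (ha m)
  · split_ifs
    · simpa using hb n
    · simpa using (norm_nonneg _).trans (hb n)
  · exact (Nat.div_le_self _ _).trans_lt (hu m)
  · exact (Nat.div_le_self _ _).trans_lt (hv n)

end Separation

/-- The Möbius function restricted to integers all of whose prime factors are `< z`. -/
noncomputable def smoothMoebius (z : ℝ) (m : ℕ) : ℂ :=
  if ∀ p : ℕ, p.Prime → p ∣ m → (p : ℝ) < z then (ArithmeticFunction.moebius m : ℂ) else 0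

lemma norm_smoothMoebius_le (z : ℝ) (m : ℕ) : ‖smoothMoebius z m‖ ≤ (m.divisors.card : ℝ) := by
  rcases Nat.eq_zero_or_pos m with rfl | hm
  · simp [smoothMoebius]
  have h1 : (1 : ℝ) ≤ m.divisors.card := by
    exact_mod_cast Finset.card_pos.2 (Nat.nonempty_divisors.2 hm.ne')
  refine le_trans ?_ h1
  unfold smoothMoebius
  split_ifs
  · rw [Complex.norm_intCast]
    exact_mod_cast ArithmeticFunction.abs_moebius_le_one
  · simp

lemma smoothMoebius_prime_mul {z : ℝ} {q d : ℕ} (hq : q.Prime) (hqz : (q : ℝ) < z)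
    (hqd : ¬ q ∣ d) : smoothMoebius z (q * d) = -smoothMoebius z d := by
  have hiff : (∀ p : ℕ, p.Prime → p ∣ q * d → (p : ℝ) < z) ↔
      ∀ p : ℕ, p.Prime → p ∣ d → (p : ℝ) < z := by
    refine ⟨fun h p hp hd => h p hp (hd.mul_left q), fun h p hp hd => ?_⟩
    rcases (hp.dvd_mul).1 hd with h' | h'
    · rwa [(Nat.prime_dvd_prime_iff_eq hp hq).1 h']
    · exact h p hp h'
  unfold smoothMoebius
  rw [ArithmeticFunction.isMultiplicative_moebius.map_mul_of_coprime
    ((Nat.Prime.coprime_iff_not_dvd hq).2 hqd), ArithmeticFunction.moebius_apply_prime hq]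
  simp only [hiff]
  split_ifs <;> simp

/-- Weight of a divisor `m` of `n` in Harman's decomposition of the sieve indicator. -/
noncomputable def harmanWeight (X z : ℝ) (n m : ℕ) : ℂ :=
  smoothMoebius z m * ((if (m : ℝ) ≤ X then 1 else 0) +
    if X < (m : ℝ) ∧ ((m / m.minFac : ℕ) : ℝ) ≤ X ∧
      (∀ p : ℕ, p.Prime → p ∣ n / m → m.minFac ≤ p) then 1 else 0)

lemma harmanWeight_add_prime_mul {X z : ℝ} {n d : ℕ} (hX : 1 ≤ X)
    (hqz : (n.minFac : ℝ) < z) (hn1 : n ≠ 1) (hd : d ∣ n) (hqd : ¬ n.minFac ∣ d) :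
    harmanWeight X z n d + harmanWeight X z n (n.minFac * d) = 0 := by
  have hq := Nat.minFac_prime hn1
  have hle : ∀ p : ℕ, p.Prime → p ∣ n → n.minFac ≤ p :=
    fun p hp h => Nat.minFac_le_of_dvd hp.two_le h
  have hqdn : n.minFac * d ∣ n :=
    ((Nat.Prime.coprime_iff_not_dvd hq).2 hqd).mul_dvd_of_dvd_of_dvd (Nat.minFac_dvd n) hd
  have hmin : (n.minFac * d).minFac = n.minFac := by
    refine le_antisymm (Nat.minFac_le_of_dvd hq.two_le (dvd_mul_right _ _)) (hle _ ?_ ?_)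
    · exact Nat.minFac_prime fun h => hq.ne_one (Nat.eq_one_of_mul_eq_one_right h)
    · exact (Nat.minFac_dvd _).trans hqdn
  have hfalse : ¬ (X < (d : ℝ) ∧ ((d / d.minFac : ℕ) : ℝ) ≤ X ∧
      ∀ p : ℕ, p.Prime → p ∣ n / d → d.minFac ≤ p) := by
    rintro ⟨h1, -, h2⟩
    have hd1 : d ≠ 1 := by
      rintro rfl
      exact (h1.trans_le (by simpa using hX)).false
    have hge := hle _ (Nat.minFac_prime hd1) ((Nat.minFac_dvd d).trans hd)
    have hdvd : n.minFac ∣ n / d := Nat.dvd_div_of_mul_dvd (by rwa [mul_comm])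
    exact hqd (le_antisymm hge (h2 _ hq hdvd) ▸ Nat.minFac_dvd d)
  have htrue : (X < ((n.minFac * d : ℕ) : ℝ) ∧
      ((n.minFac * d / (n.minFac * d).minFac : ℕ) : ℝ) ≤ X ∧
      ∀ p : ℕ, p.Prime → p ∣ n / (n.minFac * d) → (n.minFac * d).minFac ≤ p) ↔
      X < ((n.minFac * d : ℕ) : ℝ) ∧ (d : ℝ) ≤ X := by
    rw [hmin, Nat.mul_div_cancel_left _ hq.pos]
    exact ⟨fun h => ⟨h.1, h.2.1⟩, fun h =>
      ⟨h.1, h.2, fun p hp hpd => hle p hp (hpd.trans (Nat.div_dvd_of_dvd hqdn))⟩⟩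
  have hmono : (d : ℝ) ≤ ((n.minFac * d : ℕ) : ℝ) := by
    exact_mod_cast Nat.le_mul_of_pos_left d hq.pos
  simp only [harmanWeight, smoothMoebius_prime_mul hq hqz hqd, if_neg hfalse, htrue]
  rcases le_or_gt (d : ℝ) X with h1 | h1
  · rcases le_or_gt ((n.minFac * d : ℕ) : ℝ) X with h2 | h2
    · simp only [h1, h2, not_lt.2 h2, if_true, false_and, if_false]; ring
    · simp only [h1, h2, not_le.2 h2, if_true, true_and, if_false]; ring
  · simp only [not_le.2 h1, not_le.2 (h1.trans_le hmono), and_false, if_false]; ring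

/-- Harman's exact decomposition of the sieve indicator. -/
lemma sum_harmanWeight {X z : ℝ} {n : ℕ} (hX : 1 ≤ X) (hn : 0 < n) :
    ∑ m ∈ n.divisors, harmanWeight X z n m =
      if ∀ p : ℕ, p.Prime → p ∣ n → z ≤ (p : ℝ) then 1 else 0 := by
  split_ifs with hz
  · rw [Finset.sum_eq_single_of_mem 1 (Nat.one_mem_divisors.2 hn.ne')]
    · have h1 : ∀ p : ℕ, p.Prime → p = 1 → (p : ℝ) < z := fun p hp h => absurd h hp.ne_one
      simp only [harmanWeight, smoothMoebius, Nat.dvd_one, if_pos h1]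
      simp [hX, not_lt.2 hX]
    · intro m hm hm1
      have hp := Nat.minFac_prime hm1
      have hs : smoothMoebius z m = 0 := if_neg fun h =>
        (h _ hp (Nat.minFac_dvd m)).not_ge
          (hz _ hp ((Nat.minFac_dvd m).trans (Nat.dvd_of_mem_divisors hm)))
      simp [harmanWeight, hs]
  · push Not at hz
    obtain ⟨p, hp, hpn, hpz⟩ := hz
    have hn1 : n ≠ 1 := fun h => hp.ne_one (Nat.dvd_one.1 (h ▸ hpn))
    have hq := Nat.minFac_prime hn1
    have hqz : (n.minFac : ℝ) < z :=
      lt_of_le_of_lt (by exact_mod_cast Nat.minFac_le_of_dvd hp.two_le hpn) hpz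
    have hsq : ∑ m ∈ n.divisors, harmanWeight X z n m =
        ∑ m ∈ n.divisors.filter Squarefree, harmanWeight X z n m := by
      rw [Finset.sum_filter_of_ne]
      intro m _ hne
      by_contra h
      exact hne (by
        simp [harmanWeight, smoothMoebius, ArithmeticFunction.moebius_eq_zero_of_not_squarefree h])
    rw [hsq]
    have hndvd : ∀ d, Squarefree d → n.minFac ∣ d → ¬ n.minFac ∣ d / n.minFac := by
      intro d hd h h'
      exact hq.not_isUnit (hd _ ((Nat.dvd_div_iff_mul_dvd h).1 h'))
    refine Finset.sum_involution
      (fun d _ => if n.minFac ∣ d then d / n.minFac else n.minFac * d) ?_ ?_ ?_ ?_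
    · intro d hd
      obtain ⟨hdn, hds⟩ := Finset.mem_filter.1 hd
      have hdn := Nat.dvd_of_mem_divisors hdn
      split_ifs with h
      · have := harmanWeight_add_prime_mul hX hqz hn1
          ((Nat.div_dvd_of_dvd h).trans hdn) (hndvd d hds h)
        rwa [Nat.mul_div_cancel' h, add_comm] at this
      · exact harmanWeight_add_prime_mul hX hqz hn1 hdn h
    · intro d hd _ heq
      obtain ⟨hdn, hds⟩ := Finset.mem_filter.1 hd
      split_ifs at heq with h
      · exact hndvd d hds h (heq.symm ▸ h)
      · exact h (heq ▸ dvd_mul_right _ _)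
    · intro d hd
      obtain ⟨hdn, hds⟩ := Finset.mem_filter.1 hd
      have hdn := Nat.dvd_of_mem_divisors hdn
      refine Finset.mem_filter.2 ⟨Nat.mem_divisors.2 ⟨?_, hn.ne'⟩, ?_⟩
      · split_ifs with h
        · exact (Nat.div_dvd_of_dvd h).trans hdn
        · exact ((Nat.Prime.coprime_iff_not_dvd hq).2 h).mul_dvd_of_dvd_of_dvd
            (Nat.minFac_dvd n) hdn
      · split_ifs with h
        · exact hds.squarefree_of_dvd (Nat.div_dvd_of_dvd h)
        · exact (Nat.squarefree_mul ((Nat.Prime.coprime_iff_not_dvd hq).2 h)).2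
            ⟨hq.prime.squarefree, hds⟩
    · intro d hd
      obtain ⟨hdn, hds⟩ := Finset.mem_filter.1 hd
      by_cases h : n.minFac ∣ d
      · simp only [h, if_true, hndvd d hds h, if_false, Nat.mul_div_cancel' h]
      · simp only [h, if_false, dvd_mul_right, if_true, Nat.mul_div_cancel_left _ hq.pos]

/-- Coefficients of the bilinear part of Harman's decomposition. -/
noncomputable def harmanCoeff (X z : ℝ) (m : ℕ) : ℂ :=
  if ((m / m.minFac : ℕ) : ℝ) ≤ X then smoothMoebius z m else 0

/-- Least prime factor truncated at `N`, with the convention that it is `N` at `1`. -/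
def truncMinFac (N n : ℕ) : ℕ := if n = 1 then N else min n.minFac N

lemma truncMinFac_le (N n : ℕ) : truncMinFac N n ≤ N := by
  unfold truncMinFac
  split_ifs
  · exact le_rfl
  · exact min_le_right _ _

lemma harmanCoeff_mul_indicator {X z : ℝ} {N n m : ℕ} (hN : z ≤ N) (hX : 1 ≤ X) (hXm : X < m) :
    harmanCoeff X z m * (if truncMinFac N m < truncMinFac N n + 1 then 1 else 0) =
      smoothMoebius z m * if ((m / m.minFac : ℕ) : ℝ) ≤ X ∧
        (∀ p : ℕ, p.Prime → p ∣ n → m.minFac ≤ p) then 1 else 0 := by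
  have hm1 : m ≠ 1 := by
    rintro rfl
    exact (hXm.trans_le (by simpa using hX)).false
  by_cases hs : ∀ p : ℕ, p.Prime → p ∣ m → (p : ℝ) < z
  swap
  · simp [harmanCoeff, smoothMoebius, if_neg hs]
  have hmN : m.minFac ≤ N := by
    exact_mod_cast ((hs _ (Nat.minFac_prime hm1) (Nat.minFac_dvd m)).trans_le hN).le
  have hiff : truncMinFac N m < truncMinFac N n + 1 ↔
      ∀ p : ℕ, p.Prime → p ∣ n → m.minFac ≤ p := by
    rw [Nat.lt_succ_iff, truncMinFac, if_neg hm1, min_eq_left hmN, truncMinFac]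
    split_ifs with hn
    · subst hn
      exact ⟨fun _ p hp h => absurd (Nat.dvd_one.1 h) hp.ne_one, fun _ => hmN⟩
    · rw [le_min_iff]
      exact ⟨fun h p hp hpn => h.1.trans (Nat.minFac_le_of_dvd hp.two_le hpn),
        fun h => ⟨h _ (Nat.minFac_prime hn) (Nat.minFac_dvd n), hmN⟩⟩
  simp only [harmanCoeff, hiff]
  split_ifs <;> simp_all

/-- Sum of a kernel `W` over factorizations of the elements of `A`. -/
noncomputable def kernelSum (A : Finset ℕ) (Q : ℕ → Prop) : (ℕ → ℕ → ℂ) →ₗ[ℂ] ℂ where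
  toFun W := ∑ k ∈ A, ∑ m ∈ k.divisors.filter Q, W m (k / m)
  map_add' W V := by simp [Finset.sum_add_distrib]
  map_smul' c W := by simp [Finset.mul_sum]

/-- The vector of discrepancies of a kernel `W` between the families `A` and `lam * B`. -/
noncomputable def kernelDiscrepancy (P : Finset ℕ) (A B : ℕ → Finset ℕ) (lam : ℂ)
    (Q : ℕ → Prop) : (ℕ → ℕ → ℂ) →ₗ[ℂ] EuclideanSpace ℂ P :=
  (WithLp.linearEquiv 2 ℂ (P → ℂ)).symm.toLinearMap ∘ₗ
    LinearMap.pi fun p : P => kernelSum (A p) Q - lam • kernelSum (B p) Q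

lemma kernelDiscrepancy_apply (P : Finset ℕ) (A B : ℕ → Finset ℕ) (lam : ℂ) (Q : ℕ → Prop)
    (W : ℕ → ℕ → ℂ) (p : P) :
    kernelDiscrepancy P A B lam Q W p = kernelSum (A p) Q W - lam * kernelSum (B p) Q W := rfl

/-- The sieve function as a type I sum plus a kernel sum over a short range. -/
lemma sieveCount_eq {X z M : ℝ} {N : ℕ} (hN : z ≤ N) (hX : 1 ≤ X) (hXM : X ≤ M) {A : Finset ℕ}
    (hA : ∀ n ∈ A, 0 < n) :
    (sieveCount A z : ℂ) =
      typeISum A (fun m => (m : ℝ) ≤ M) (fun m => if (m : ℝ) ≤ X then smoothMoebius z m else 0) +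
      kernelSum A (fun m => X < (m : ℝ) ∧ (m : ℝ) ≤ X * z) (fun m n =>
        harmanCoeff X z m * (if n = 0 then 0 else 1) *
          if truncMinFac N m < truncMinFac N n + 1 then 1 else 0) := by
  rw [sieveCount, Finset.card_filter, Nat.cast_sum, typeISum]
  change _ = _ + ∑ k ∈ A, _
  rw [← Finset.sum_add_distrib]
  refine Finset.sum_congr rfl fun n hn => ?_
  have hn0 := hA n hn
  have h := sum_harmanWeight (z := z) hX hn0
  rw [Nat.cast_ite, Nat.cast_one, Nat.cast_zero, ← h, Finset.sum_filter, Finset.sum_filter,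
    ← Finset.sum_add_distrib]
  refine Finset.sum_congr rfl fun m hm => ?_
  have hmn := Nat.dvd_of_mem_divisors hm
  have hm0 : 0 < m := Nat.pos_of_dvd_of_pos hmn hn0
  have hnm : n / m ≠ 0 := (Nat.div_pos (Nat.le_of_dvd hn0 hmn) hm0).ne'
  rw [harmanWeight, mul_add]
  congr 1
  · split_ifs <;> simp_all; linarith
  · by_cases hXm : X < (m : ℝ)
    swap
    · simp [hXm]
    have hm1 : m ≠ 1 := by
      rintro rfl
      exact (hXm.trans_le (by simpa using hX)).false
    beta_reduce
    rw [if_neg hnm, mul_one, harmanCoeff_mul_indicator hN hX hXm]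
    simp only [hXm, true_and]
    by_cases hle : (m : ℝ) ≤ X * z
    · simp only [hle, if_true]
    rw [if_neg hle]
    by_cases hs : ∀ p : ℕ, p.Prime → p ∣ m → (p : ℝ) < z
    swap
    · simp [smoothMoebius, if_neg hs]
    rw [if_neg, mul_zero]
    rintro ⟨h1, -⟩
    apply hle
    have h2 := hs _ (Nat.minFac_prime hm1) (Nat.minFac_dvd m)
    calc (m : ℝ) = ((m / m.minFac : ℕ) : ℝ) * m.minFac := by
          exact_mod_cast (Nat.div_mul_cancel (Nat.minFac_dvd m)).symm
      _ ≤ X * z := by gcongr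

/-- **Average version of Harman's asymptotic sieve.** With an absolute implied
constant: if for all divisor-bounded sequences `(a_m)`, `(b_n)` the mean-square
type I and type II information over `p ∈ P` holds with bound `Y`, then
`∑_{p ∈ P} |S(A_p, x^β) - λ S(B_p, x^β)|² = O(Y (log x)^6)`. -/
theorem harman_asymptotic_sieve_average :
    ∃ K : ℝ, 0 < K ∧
      ∀ x : ℝ, 2 ≤ x → ∀ P : Finset ℕ, ∀ A B : ℕ → Finset ℕ,
        (∀ p ∈ P, ∀ n ∈ A p, 0 < n) → (∀ p ∈ P, ∀ n ∈ B p, 0 < n) →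
      ∀ lam α β M Y : ℝ, 0 < lam → 0 < α → α < 1 → 0 < β → β ≤ 1 / 2 →
        x ^ α < M → 1 ≤ Y →
      (∀ a b : ℕ → ℂ, (∀ m, ‖a m‖ ≤ (m.divisors.card : ℝ)) →
          (∀ n, ‖b n‖ ≤ (n.divisors.card : ℝ)) →
        (∑ p ∈ P, ‖typeISum (A p) (fun m => (m : ℝ) ≤ M) a
            - lam * typeISum (B p) (fun m => (m : ℝ) ≤ M) a‖ ^ 2) ≤ Y ∧
        (∑ p ∈ P, ‖typeIISum (A p) (fun m => x ^ α < (m : ℝ) ∧ (m : ℝ) ≤ x ^ (α + β)) a b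
            - lam * typeIISum (B p) (fun m => x ^ α < (m : ℝ) ∧ (m : ℝ) ≤ x ^ (α + β)) a b‖ ^ 2)
          ≤ Y) →
      (∑ p ∈ P, ((sieveCount (A p) (x ^ β) : ℝ) - lam * (sieveCount (B p) (x ^ β) : ℝ)) ^ 2)
        ≤ K * Y * Real.log x ^ 6 := by
  refine ⟨1024, by norm_num, ?_⟩
  intro x hx P A B hA hB lam α β M Y hlam hα hα1 hβ hβ2 hM hY hyp
  have hx0 : 0 < x := by linarith
  set X := x ^ α
  set z := x ^ β
  have hX : 1 ≤ X := Real.one_le_rpow (by linarith) hα.le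
  have hz0 : 0 ≤ z := Real.rpow_nonneg hx0.le β
  have hzx : z ≤ x := by
    simpa using Real.rpow_le_rpow_of_exponent_le (by linarith : 1 ≤ x) (by linarith : β ≤ 1)
  have hXz : x ^ (α + β) = X * z := Real.rpow_add hx0 α β
  rw [hXz] at hyp
  set N := ⌈z⌉₊
  have hN : z ≤ N := Nat.le_ceil z
  set L := Nat.log 2 (N + 1) + 1 with hLdef
  have hNL : N + 1 < 2 ^ L := Nat.lt_pow_succ_log_self one_lt_two _
  have hlog2 : 1 / 2 < Real.log 2 := by linarith [Real.log_two_gt_d9]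
  have hlogx : 1 / 2 < Real.log x := hlog2.trans_le (Real.log_le_log (by norm_num) hx)
  have hL : (L : ℝ) ≤ 1 + 4 * Real.log x := by
    have h1 : ((2 ^ Nat.log 2 (N + 1) : ℕ) : ℝ) ≤ ((N + 1 : ℕ) : ℝ) := by
      exact_mod_cast Nat.pow_log_le_self 2 (Nat.succ_ne_zero N)
    have h2 : (N : ℝ) < z + 1 := Nat.ceil_lt_add_one hz0
    have h3 : (2 : ℝ) ^ Nat.log 2 (N + 1) ≤ x ^ 2 := by
      push_cast at h1
      nlinarith
    have h4 := Real.log_le_log (by positivity) h3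
    rw [Real.log_pow, Real.log_pow] at h4
    have h5 : (0 : ℝ) ≤ Nat.log 2 (N + 1) := Nat.cast_nonneg _
    push_cast [hLdef] at h4 ⊢
    nlinarith
  set Q : ℕ → Prop := fun m => X < (m : ℝ) ∧ (m : ℝ) ≤ X * z
  let T := kernelDiscrepancy P A B lam Q
  have hsq : ∀ W : EuclideanSpace ℂ P, ∀ C : ℝ, ∑ p, ‖W p‖ ^ 2 ≤ C → ‖W‖ ≤ √C := by
    intro W C h
    rw [EuclideanSpace.norm_eq]
    exact Real.sqrt_le_sqrt h
  have hT : ∀ a b : ℕ → ℂ, (∀ m, ‖a m‖ ≤ (m.divisors.card : ℝ)) →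
      (∀ n, ‖b n‖ ≤ (n.divisors.card : ℝ)) → ‖T (fun m n => a m * b n)‖ ≤ √Y := by
    intro a b ha hb
    refine hsq _ _ ?_
    have h := (hyp a b ha hb).2
    rw [← Finset.sum_coe_sort] at h
    exact h
  set a₁ : ℕ → ℂ := fun m => if (m : ℝ) ≤ X then smoothMoebius z m else 0 with ha₁def
  have ha₁ : ∀ m, ‖a₁ m‖ ≤ (m.divisors.card : ℝ) := by
    intro m
    simp only [ha₁def]
    split_ifs
    · exact norm_smoothMoebius_le z m
    · simp
  have ha₂ : ∀ m, ‖harmanCoeff X z m‖ ≤ (m.divisors.card : ℝ) := by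
    intro m
    unfold harmanCoeff
    split_ifs
    · exact norm_smoothMoebius_le z m
    · simp
  have hb₂ : ∀ n : ℕ, ‖(if n = 0 then 0 else 1 : ℂ)‖ ≤ (n.divisors.card : ℝ) := by
    intro n
    split_ifs with h
    · simp
    · simpa using Finset.card_pos.2 (Nat.nonempty_divisors.2 h)
  set W : ℕ → ℕ → ℂ := fun m n => harmanCoeff X z m * (if n = 0 then 0 else 1) *
    if truncMinFac N m < truncMinFac N n + 1 then 1 else 0
  have hTW : ‖T W‖ ≤ L * √Y :=
    norm_map_mul_indicator_lt_le T hT ha₂ hb₂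
      (fun m => ((truncMinFac_le N m).trans_lt (Nat.lt_succ_self N)).trans hNL)
      (fun n => (Nat.succ_le_succ (truncMinFac_le N n)).trans_lt hNL)
  let S : EuclideanSpace ℂ P := WithLp.toLp 2 fun p : P =>
    typeISum (A p) (fun m => (m : ℝ) ≤ M) a₁ - lam * typeISum (B p) (fun m => (m : ℝ) ≤ M) a₁
  have hS : ‖S‖ ≤ √Y := by
    refine hsq _ _ ?_
    have h := (hyp a₁ _ ha₁ hb₂).1
    rw [← Finset.sum_coe_sort] at h
    exact h
  have hSTW : ‖S + T W‖ ≤ 8 * Real.log x * √Y := by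
    calc ‖S + T W‖ ≤ √Y + L * √Y := norm_add_le_of_le hS hTW
      _ = (1 + L) * √Y := by ring
      _ ≤ 8 * Real.log x * √Y := by gcongr; linarith
  have hfin : ∑ p ∈ P, ((sieveCount (A p) z : ℝ) - lam * (sieveCount (B p) z : ℝ)) ^ 2 =
      ‖S + T W‖ ^ 2 := by
    rw [EuclideanSpace.norm_sq_eq, ← Finset.sum_coe_sort]
    refine Finset.sum_congr rfl fun p _ => ?_
    have hp : (S + T W) p =
        (((sieveCount (A p) z : ℝ) - lam * (sieveCount (B p) z : ℝ) : ℝ) : ℂ) := by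
      push_cast
      rw [sieveCount_eq hN hX hM.le (hA p p.2), sieveCount_eq hN hX hM.le (hB p p.2)]
      simp only [PiLp.add_apply, S, T, kernelDiscrepancy_apply]
      ring
    rw [hp, Complex.norm_real, Real.norm_eq_abs, sq_abs]
  rw [hfin]
  have hlog4 : 1 ≤ 16 * Real.log x ^ 4 := by
    have := pow_le_pow_left₀ (by norm_num) hlogx.le 4
    linarith
  calc ‖S + T W‖ ^ 2 ≤ (8 * Real.log x * √Y) ^ 2 := by gcongr
    _ = 64 * Y * Real.log x ^ 2 * 1 := by
      rw [mul_pow, Real.sq_sqrt (by linarith)]; ring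
    _ ≤ 64 * Y * Real.log x ^ 2 * (16 * Real.log x ^ 4) := by gcongr
    _ = 1024 * Y * Real.log x ^ 6 := by ring
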